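/- Dominance of the replica-symmetric saddle for Rényi entropies (fixed-area, two surfaces, pure bulk state): let ρ_{bb'} be a pure state, n ≥ 2 an integer, Δ a real number, and τ the full cycle. If H_n(ρ_b) ≤ Δ, then for every non-crossing π ∈ S_n, 2^{(n−|π|)Δ}·Tr(ρ_b^n) ≥ Tr(ρ_{bb'}^{⊗n}·U_{τ|b^n}⊗U_{π|b'^n}); if H_n(ρ_b) ≥ Δ, then 2^{(1−|π|)Δ} ≥ Tr(ρ_{bb'}^{⊗n}·U_{τ|b^n}⊗U_{π|b'^n}). -/

import Mathlib

open Matrix ComplexOrder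

/-- The `n`-fold tensor power `ρ^{⊗n}` of a matrix, as a matrix on `H^{⊗n}`
(indexed by functions `Fin n → ι`). -/
noncomputable def tensorPow {ι : Type} [Fintype ι] (ρ : Matrix ι ι ℂ) (n : ℕ) :
    Matrix (Fin n → ι) (Fin n → ι) ℂ :=
  Matrix.of fun f g => ∏ i, ρ (f i) (g i)

/-- The unitary `U_σ` permuting the `n` tensor factors of `H^{⊗n}` according to `σ`:
`U_σ (v₁ ⊗ ⋯ ⊗ v_n) = v_{σ⁻¹(1)} ⊗ ⋯ ⊗ v_{σ⁻¹(n)}`. -/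
noncomputable def permMatrix (d n : ℕ) (σ : Equiv.Perm (Fin n)) :
    Matrix (Fin n → Fin d) (Fin n → Fin d) ℂ :=
  Matrix.of fun f g => if ∀ i, f i = g (σ⁻¹ i) then 1 else 0

/-- The unitary `U_{σA|A^n} ⊗ U_{σB|B^n}` on `(H_A ⊗ H_B)^{⊗n}` which permutes the `A`
tensor factors by `σA` and the `B` tensor factors by `σB`. -/
noncomputable def permPairMatrix (dA dB n : ℕ) (σA σB : Equiv.Perm (Fin n)) :
    Matrix (Fin n → Fin dA × Fin dB) (Fin n → Fin dA × Fin dB) ℂ :=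
  Matrix.of fun f g =>
    if ∀ i, f i = ((g (σA⁻¹ i)).1, (g (σB⁻¹ i)).2) then 1 else 0

/-- The reduced state `ρ_A = Tr_B ρ_{AB}` (partial trace over the second factor). -/
noncomputable def ptraceB {dA dB : ℕ}
    (ρ : Matrix (Fin dA × Fin dB) (Fin dA × Fin dB) ℂ) : Matrix (Fin dA) (Fin dA) ℂ :=
  Matrix.of fun a a' => ∑ b, ρ (a, b) (a', b)
/-- The number of cycles of a permutation, counting fixed points as 1-cycles. -/
def cycleCount {n : ℕ} (π : Equiv.Perm (Fin n)) : ℕ :=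
  π.cycleType.card + (Finset.univ.filter fun x => π x = x).card

/-- The cycle (orbit) partition of `π` is non-crossing: there are no
`a₁ < b₁ < a₂ < b₂` with `a₁, a₂` in one cycle and `b₁, b₂` in a different cycle. -/
def HasNonCrossingCycles {n : ℕ} (π : Equiv.Perm (Fin n)) : Prop :=
  ¬ ∃ a₁ b₁ a₂ b₂ : Fin n, a₁ < b₁ ∧ b₁ < a₂ ∧ a₂ < b₂ ∧
      π.SameCycle a₁ a₂ ∧ π.SameCycle b₁ b₂ ∧ ¬ π.SameCycle a₁ b₁

/-- Each cycle of `π` traverses its elements (its block) in increasing cyclic order: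
`π x` is the least element of the orbit of `x` strictly above `x` if one exists, and
the least element of the orbit otherwise. -/
def CyclicallyIncreasing {n : ℕ} (π : Equiv.Perm (Fin n)) : Prop :=
  ∀ x : Fin n,
    ((∃ y, π.SameCycle x y ∧ x < y) →
        x < π x ∧ ∀ y, π.SameCycle x y → x < y → π x ≤ y) ∧
    ((∀ y, π.SameCycle x y → y ≤ x) → ∀ y, π.SameCycle x y → π x ≤ y)

/-- A non-crossing permutation: the permutation obtained from a non-crossing partition
by taking each block in increasing cyclic order. -/
def IsNonCrossingPerm {n : ℕ} (π : Equiv.Perm (Fin n)) : Prop :=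
  HasNonCrossingCycles π ∧ CyclicallyIncreasing π

/-- The trace of `A^{⊗n}` against the permutation `σ` of the tensor factors. -/
noncomputable def permTrace {α m R : Type*} [Fintype α] [DecidableEq α] [Fintype m]
    [CommSemiring R] (σ : Equiv.Perm α) (A : Matrix m m R) : R :=
  ∑ a : α → m, ∏ i, A (a i) (a (σ i))

theorem permTrace_mul_comm {α m k R : Type*} [Fintype α] [DecidableEq α] [Fintype m] [Fintype k]
    [CommSemiring R] (σ : Equiv.Perm α) (A : Matrix m k R) (B : Matrix k m R) :
    permTrace σ (A * B) = permTrace σ (B * A) := by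
  simp only [permTrace, Matrix.mul_apply, Finset.prod_univ_sum, Fintype.piFinset_univ]
  rw [Finset.sum_comm]
  refine Finset.sum_congr rfl fun c _ => ?_
  rw [← (Equiv.arrowCongr σ (Equiv.refl m)).sum_comp]
  refine Finset.sum_congr rfl fun a _ => ?_
  simp only [Finset.prod_mul_distrib, Equiv.arrowCongr_apply, Equiv.coe_refl, Function.comp_apply,
    id_eq, Equiv.symm_apply_apply]
  rw [mul_comm]
  congr 1
  rw [← Equiv.prod_comp σ]
  simp

theorem trace_tensorPow_mul_permPairMatrix {dA dB n : ℕ} (v : Fin dA × Fin dB → ℂ)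
    (σA σB : Equiv.Perm (Fin n)) :
    (tensorPow (Matrix.vecMulVec v (star v)) n * permPairMatrix dA dB n σA σB).trace =
      permTrace (σA⁻¹ * σB) (ptraceB (Matrix.vecMulVec v (star v))) := by
  have hg (f : Fin n → Fin dA × Fin dB) (g : Fin n → Fin dA × Fin dB) :
      (∀ i, g i = ((f (σA⁻¹ i)).1, (f (σB⁻¹ i)).2)) ↔
        g = fun i => ((f (σA⁻¹ i)).1, (f (σB⁻¹ i)).2) := funext_iff.symm
  simp only [Matrix.trace, Matrix.diag_apply, Matrix.mul_apply, tensorPow, permPairMatrix,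
    Matrix.of_apply, hg, mul_ite, mul_one, mul_zero, Finset.sum_ite_eq', Finset.mem_univ, if_true,
    permTrace, ptraceB, Finset.prod_univ_sum, Fintype.piFinset_univ]
  rw [← (Equiv.arrowProdEquivProdArrow (Fin n) (fun _ => Fin dA) (fun _ => Fin dB)).symm.sum_comp,
    Fintype.sum_prod_type]
  refine Finset.sum_congr rfl fun a _ => Finset.sum_congr rfl fun b _ => ?_
  simp only [Matrix.vecMulVec_apply, Finset.prod_mul_distrib]
  congr 1
  rw [← Equiv.prod_comp σB]
  simp [Equiv.arrowProdEquivProdArrow]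

/-- The number of orbits of a permutation. -/
noncomputable def orbitCount {α : Type*} (σ : Equiv.Perm α) : ℕ :=
  Nat.card (Quotient (Equiv.Perm.SameCycle.setoid σ))

theorem eq_of_sameCycle_of_invariant {α β : Type*} {σ : Equiv.Perm α} {c : α → β}
    (hc : ∀ i, c (σ i) = c i) {x y : α} (h : σ.SameCycle x y) : c x = c y := by
  have hn (k : ℕ) (z : α) : c ((σ ^ k) z) = c z := by
    induction k with
    | zero => simp
    | succ k ih => rw [pow_succ', Equiv.Perm.mul_apply, hc, ih]
  obtain ⟨k, rfl⟩ := h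
  obtain ⟨k, rfl | rfl⟩ := k.eq_nat_or_neg
  · simp [hn]
  · rw [_root_.zpow_neg, zpow_natCast, ← hn k ((σ ^ k)⁻¹ x),
      ← Equiv.Perm.mul_apply, mul_inv_cancel, Equiv.Perm.one_apply]

/-- Functions invariant under a permutation are functions on its set of orbits. -/
def invariantEquiv {α : Type*} (β : Type*) (σ : Equiv.Perm α) :
    {c : α → β // ∀ i, c (σ i) = c i} ≃ (Quotient (Equiv.Perm.SameCycle.setoid σ) → β) where
  toFun c := Quotient.lift c.1 fun _ _ h => eq_of_sameCycle_of_invariant c.2 h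
  invFun q := ⟨fun i => q ⟦i⟧, fun i => congrArg q (Quotient.sound
    (Equiv.Perm.sameCycle_apply_left.2 (Equiv.Perm.SameCycle.refl σ i)))⟩
  left_inv c := by ext; rfl
  right_inv q := by
    ext x
    induction x using Quotient.inductionOn
    rfl

theorem permTrace_diagonal {α m R : Type*} [Fintype α] [DecidableEq α] [Fintype m] [DecidableEq m]
    [CommSemiring R] (σ : Equiv.Perm α) [Fintype (Quotient (Equiv.Perm.SameCycle.setoid σ))]
    [DecidableEq (Quotient (Equiv.Perm.SameCycle.setoid σ))] (d : m → R) :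
    permTrace σ (Matrix.diagonal d) =
      ∏ x : Quotient (Equiv.Perm.SameCycle.setoid σ),
        ∑ j, d j ^ (Finset.univ.filter fun i : α => (⟦i⟧ : Quotient _) = x).card := by
  have h (a : α → m) : ∏ i, Matrix.diagonal d (a i) (a (σ i)) =
      if ∀ i, a (σ i) = a i then ∏ i, d (a i) else 0 := by
    split_ifs with h
    · exact Finset.prod_congr rfl fun i _ => by rw [h, Matrix.diagonal_apply_eq]
    · push Not at h
      obtain ⟨i, hi⟩ := h
      exact Finset.prod_eq_zero (Finset.mem_univ i) (Matrix.diagonal_apply_ne' _ hi)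
  simp only [permTrace, h, Finset.prod_univ_sum, Fintype.piFinset_univ]
  rw [← Finset.sum_filter,
    Finset.sum_subtype (p := fun a : α → m => ∀ i, a (σ i) = a i) _ (by simp),
    ← (invariantEquiv m σ).symm.sum_comp]
  refine Finset.sum_congr rfl fun q _ => ?_
  rw [← Finset.prod_fiberwise Finset.univ
    (fun i : α => (⟦i⟧ : Quotient (Equiv.Perm.SameCycle.setoid σ)))]
  refine Finset.prod_congr rfl fun x _ => ?_
  rw [← Finset.prod_const]
  refine Finset.prod_congr rfl fun i hi => ?_
  rw [← (Finset.mem_filter.1 hi).2]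
  rfl

theorem orbitCount_add_orbitCount_le {α : Type*} [Fintype α] [Nonempty α] (σ π : Equiv.Perm α)
    (h : ∀ c : α → ℝ, (∀ i, c (σ i) = c i) → (∀ i, c (π i) = c i) → ∀ i j, c i = c j) :
    orbitCount σ + orbitCount π ≤ Fintype.card α + 1 := by
  classical
  let V (ρ : Equiv.Perm α) : Submodule ℝ (α → ℝ) :=
    LinearMap.range (LinearMap.funLeft ℝ ℝ (Quotient.mk (Equiv.Perm.SameCycle.setoid ρ)))
  have hV (ρ : Equiv.Perm α) : Module.finrank ℝ (V ρ) = orbitCount ρ := by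
    rw [LinearMap.finrank_range_of_inj
      (LinearMap.funLeft_injective_of_surjective ℝ ℝ _ Quotient.mk_surjective),
      Module.finrank_fintype_fun_eq_card, orbitCount, Nat.card_eq_fintype_card]
  have hinv (ρ : Equiv.Perm α) (c : α → ℝ) (hc : c ∈ V ρ) (i : α) : c (ρ i) = c i := by
    obtain ⟨q, rfl⟩ := hc
    exact ((invariantEquiv ℝ ρ).symm q).2 i
  have hinf : V σ ⊓ V π ≤ Submodule.span ℝ {fun _ => 1} := by
    intro c hc
    obtain ⟨i₀⟩ := ‹Nonempty α›
    refine Submodule.mem_span_singleton.2 ⟨c i₀, ?_⟩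
    ext j
    simpa using h c (hinv σ c hc.1) (hinv π c hc.2) i₀ j
  have h1 : Module.finrank ℝ ↥(V σ ⊓ V π) ≤ 1 :=
    (Submodule.finrank_mono hinf).trans ((finrank_span_le_card _).trans_eq (by simp))
  have h2 : Module.finrank ℝ ↥(V σ ⊔ V π) ≤ Fintype.card α := by
    simpa using Submodule.finrank_le (V σ ⊔ V π)
  have h3 := Submodule.finrank_sup_add_finrank_inf_eq (V σ) (V π)
  rw [hV, hV] at h3
  omega

theorem eq_of_finRotate_invariant {n : ℕ} {β : Type*} {c : Fin n → β}
    (hc : ∀ i, c (finRotate n i) = c i) (i j : Fin n) : c i = c j := by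
  obtain _ | n := n
  · exact i.elim0
  have h0 (i : Fin (n + 1)) : c i = c 0 := by
    induction i using Fin.induction with
    | zero => rfl
    | succ i ih => rw [← ih, ← hc i.castSucc, finRotate_apply, Fin.coeSucc_eq_succ]
  rw [h0 i, h0 j]

theorem orbitCount_finRotate_inv_mul_add_le {n : ℕ} (hn : n ≠ 0) (π : Equiv.Perm (Fin n)) :
    orbitCount ((finRotate n)⁻¹ * π) + orbitCount π ≤ n + 1 := by
  have : Nonempty (Fin n) := ⟨⟨0, Nat.pos_of_ne_zero hn⟩⟩
  refine (orbitCount_add_orbitCount_le _ π fun c hσ hπ =>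
    eq_of_finRotate_invariant fun i => ?_).trans_eq (by simp)
  obtain ⟨j, hj⟩ := π.surjective (finRotate n i)
  have h := hσ j
  rw [Equiv.Perm.mul_apply, hj, ← Equiv.Perm.mul_apply, inv_mul_cancel, Equiv.Perm.one_apply] at h
  rw [← hj, hπ, h]

theorem orbitCount_le {n : ℕ} (π : Equiv.Perm (Fin n)) : orbitCount π ≤ n := by
  simpa [orbitCount] using Nat.card_le_card_of_surjective _
    (Quotient.mk_surjective (s := Equiv.Perm.SameCycle.setoid π))

theorem cycleCount_le_orbitCount {n : ℕ} (π : Equiv.Perm (Fin n)) :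
    cycleCount π ≤ orbitCount π := by
  have hne (c : π.cycleFactorsFinset) : ∃ x, x ∈ c.1.support :=
    Finset.nonempty_iff_ne_empty.2 fun h =>
      (Equiv.Perm.mem_cycleFactorsFinset_iff.1 c.2).1.ne_one (Equiv.Perm.support_eq_empty_iff.1 h)
  choose r hr using hne
  have hcyc (c : π.cycleFactorsFinset) : c.1 = π.cycleOf (r c) :=
    Equiv.Perm.cycle_is_cycleOf (hr c) c.2
  have hmov (c : π.cycleFactorsFinset) : π (r c) ≠ r c := by
    rw [← Equiv.Perm.mem_support, ← Equiv.Perm.cycleOf_mem_cycleFactorsFinset_iff, ← hcyc c]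
    exact c.2
  let rep : π.cycleFactorsFinset ⊕ {x : Fin n // π x = x} → Fin n := Sum.elim r Subtype.val
  have hinj : Function.Injective fun s =>
      (Quotient.mk (Equiv.Perm.SameCycle.setoid π) (rep s)) := by
    intro s t hst
    have h : π.SameCycle (rep s) (rep t) := Quotient.exact hst
    rcases s with c | x <;> rcases t with d | y
    · exact congrArg Sum.inl (Subtype.ext ((hcyc c).trans (h.cycleOf_eq.trans (hcyc d).symm)))
    · exact absurd (h.apply_eq_self_iff.2 y.2) (hmov c)
    · exact absurd (h.apply_eq_self_iff.1 x.2) (hmov d)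
    · exact congrArg Sum.inr (Subtype.ext (h.eq_of_left x.2))
  have h := Nat.card_le_card_of_injective _ hinj
  rw [Nat.card_sum, Nat.card_eq_fintype_card, Nat.card_eq_fintype_card, Fintype.card_coe,
    Fintype.card_subtype] at h
  simpa [cycleCount, orbitCount, Equiv.Perm.cycleType_def] using h

theorem cycleCount_pos {n : ℕ} (hn : n ≠ 0) (π : Equiv.Perm (Fin n)) : 0 < cycleCount π := by
  by_cases h : π = 1
  · subst h
    simpa [cycleCount] using Nat.pos_of_ne_zero hn
  · exact Nat.add_pos_left (Equiv.Perm.card_cycleType_pos.2 h) _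

theorem sum_pow_pos {m : Type*} [Fintype m] {w : m → ℝ} (hw : ∀ j, 0 ≤ w j)
    (hsum : ∑ j, w j = 1) (n : ℕ) : 0 < ∑ j, w j ^ n := by
  obtain ⟨j, -, hj⟩ := Finset.exists_ne_zero_of_sum_ne_zero (hsum.trans_ne one_ne_zero)
  exact Finset.sum_pos' (fun j _ => pow_nonneg (hw j) n)
    ⟨j, Finset.mem_univ j, pow_pos ((hw j).lt_of_ne' hj) n⟩

theorem sum_pow_le_one {m : Type*} [Fintype m] {w : m → ℝ} (hw : ∀ j, 0 ≤ w j)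
    (hsum : ∑ j, w j = 1) {n : ℕ} (hn : n ≠ 0) : ∑ j, w j ^ n ≤ 1 := by
  rw [← hsum]
  refine Finset.sum_le_sum fun j _ => pow_le_of_le_one (hw j) ?_ hn
  exact hsum ▸ Finset.single_le_sum (fun j _ => hw j) (Finset.mem_univ j)

/-- Monotonicity of the Rényi entropies, in terms of power sums. -/
theorem sum_pow_le_rpow {m : Type*} [Fintype m] {w : m → ℝ} (hw : ∀ j, 0 ≤ w j)
    (hsum : ∑ j, w j = 1) {k n : ℕ} (hk : 1 ≤ k) (hkn : k ≤ n) (hn : 2 ≤ n) :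
    ∑ j, w j ^ k ≤ (∑ j, w j ^ n) ^ (((k : ℝ) - 1) / ((n : ℝ) - 1)) := by
  obtain ⟨k, rfl⟩ := Nat.exists_eq_add_of_le' hk
  obtain ⟨n, rfl⟩ := Nat.exists_eq_add_of_le' (one_le_two.trans hn)
  have hn0 : (0 : ℝ) < n := by exact_mod_cast (by omega : 0 < n)
  push_cast
  rw [add_sub_cancel_right, add_sub_cancel_right]
  obtain rfl | hk0 := k.eq_zero_or_pos
  · simp [hsum]
  have hk0 : (0 : ℝ) < k := by exact_mod_cast hk0
  have h := Real.rpow_arith_mean_le_arith_mean_rpow Finset.univ w (fun j => w j ^ k)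
    (fun j _ => hw j) hsum (fun j _ => pow_nonneg (hw j) k) (p := (n : ℝ) / k)
    ((one_le_div hk0).2 (by exact_mod_cast (by omega : k ≤ n)))
  have hz (j : m) : w j * (w j ^ k) ^ ((n : ℝ) / k) = w j ^ (n + 1) := by
    rw [← Real.rpow_natCast_mul (hw j), mul_div_cancel₀ _ hk0.ne', Real.rpow_natCast, pow_succ']
  simp only [hz, ← pow_succ'] at h
  have h0 := (sum_pow_pos hw hsum (k + 1)).le
  calc _ = ((∑ j, w j ^ (k + 1)) ^ ((n : ℝ) / k)) ^ ((k : ℝ) / n) := by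
        rw [← Real.rpow_mul h0, div_mul_div_cancel₀ hk0.ne', div_self hn0.ne', Real.rpow_one]
    _ ≤ _ := Real.rpow_le_rpow (Real.rpow_nonneg h0 _) h (by positivity)

theorem permTrace_diagonal_le_rpow {m : Type*} [Fintype m] [DecidableEq m] {w : m → ℝ}
    (hw : ∀ j, 0 ≤ w j) (hsum : ∑ j, w j = 1) {n : ℕ} (hn : 2 ≤ n)
    (σ : Equiv.Perm (Fin n)) :
    permTrace σ (Matrix.diagonal w) ≤
      (∑ j, w j ^ n) ^ (((n : ℝ) - orbitCount σ) / ((n : ℝ) - 1)) := by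
  classical
  rw [permTrace_diagonal]
  have hp := sum_pow_pos hw hsum n
  set N := fun x : Quotient (Equiv.Perm.SameCycle.setoid σ) =>
    (Finset.univ.filter fun i : Fin n => (⟦i⟧ : Quotient _) = x).card
  have hN : ∑ x, N x = n := by
    simpa using (Finset.card_eq_sum_card_fiberwise (s := Finset.univ) (t := Finset.univ)
      (f := fun i : Fin n => (⟦i⟧ : Quotient (Equiv.Perm.SameCycle.setoid σ)))
      (by simp)).symm
  have hexp : ∑ x, ((N x : ℝ) - 1) / ((n : ℝ) - 1) = ((n : ℝ) - orbitCount σ) / ((n : ℝ) - 1) := by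
    rw [← Finset.sum_div, Finset.sum_sub_distrib, ← Nat.cast_sum, hN]
    simp [orbitCount]
  rw [← hexp, Real.rpow_sum_of_pos hp]
  refine Finset.prod_le_prod (fun x _ => (sum_pow_pos hw hsum _).le) fun x _ =>
    sum_pow_le_rpow hw hsum ?_ ?_ hn
  · obtain ⟨i, hi⟩ := Quotient.exists_rep x
    exact Finset.card_pos.2 ⟨i, by simpa using hi⟩
  · exact (Finset.card_le_univ _).trans_eq (Fintype.card_fin n)

theorem exists_permTrace_eq_of_posSemidef {m : Type*} [Fintype m] [DecidableEq m]
    {A : Matrix m m ℂ} (hA : A.PosSemidef) (htr : A.trace = 1) :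
    ∃ w : m → ℝ, (∀ j, 0 ≤ w j) ∧ ∑ j, w j = 1 ∧
      (∀ n : ℕ, (A ^ n).trace = ((∑ j, w j ^ n : ℝ) : ℂ)) ∧
      ∀ (n : ℕ) (σ : Equiv.Perm (Fin n)),
        permTrace σ A = ((permTrace σ (Matrix.diagonal w) : ℝ) : ℂ) := by
  have hd : ∃ U : Matrix.unitaryGroup m ℂ, A = U.1 * (Matrix.diagonal
      (fun j => (hA.1.eigenvalues j : ℂ)) * star U.1) := by
    refine ⟨hA.1.eigenvectorUnitary, ?_⟩
    conv_lhs => rw [hA.1.spectral_theorem, Unitary.conjStarAlgAut_apply, mul_assoc]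
    rfl
  obtain ⟨U, hU⟩ := hd
  set w := hA.1.eigenvalues
  set D := Matrix.diagonal fun j => (w j : ℂ) with hD
  have hUU : star U.1 * U.1 = 1 := Unitary.coe_star_mul_self U
  have hpow (n : ℕ) : A ^ n = U.1 * (D ^ n * star U.1) := by
    induction n with
    | zero => simp
    | succ n ih =>
      rw [pow_succ, ih, hU, pow_succ]
      simp only [mul_assoc]
      rw [← mul_assoc (star U.1) U.1, hUU, one_mul]
  have htrpow (n : ℕ) : (A ^ n).trace = ((∑ j, w j ^ n : ℝ) : ℂ) := by
    rw [hpow, Matrix.trace_mul_comm, mul_assoc, hUU, mul_one, hD, Matrix.diagonal_pow]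
    simp
  refine ⟨w, hA.eigenvalues_nonneg, ?_, htrpow, fun n σ => ?_⟩
  · have h := htrpow 1
    rw [pow_one, htr] at h
    simp only [pow_one] at h
    exact_mod_cast h.symm
  · rw [hU, permTrace_mul_comm, mul_assoc, hUU, mul_one, hD]
    simp only [permTrace, Complex.ofReal_sum, Complex.ofReal_prod, Matrix.diagonal_apply]
    refine Finset.sum_congr rfl fun a _ => Finset.prod_congr rfl fun i _ => ?_
    split_ifs <;> simp

theorem trace_ptraceB {dA dB : ℕ} (ρ : Matrix (Fin dA × Fin dB) (Fin dA × Fin dB) ℂ) :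
    (ptraceB ρ).trace = ρ.trace := by
  simp [Matrix.trace, ptraceB, Fintype.sum_prod_type]

theorem posSemidef_ptraceB_vecMulVec {dA dB : ℕ} (v : Fin dA × Fin dB → ℂ) :
    (ptraceB (Matrix.vecMulVec v (star v))).PosSemidef := by
  have h : ptraceB (Matrix.vecMulVec v (star v)) =
      Matrix.of (Function.curry v) * (Matrix.of (Function.curry v))ᴴ := by
    ext a a'
    simp [ptraceB, Matrix.mul_apply, Matrix.vecMulVec_apply]
  rw [h]
  exact Matrix.posSemidef_self_mul_conjTranspose _

/-- **Dominance of the replica-symmetric saddle for Rényi entropies**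
(fixed-area, two surfaces, pure bulk state). Let `ρ_{bb'}` be a pure state,
`n ≥ 2` an integer, `Δ` a real number, and `τ = (1 2 … n)` the full cycle. For every
non-crossing `π ∈ S_n`:
if `H_n(ρ_b) ≤ Δ`, then `2^{(n-|π|)Δ}·Tr(ρ_b^n) ≥ Tr(ρ_{bb'}^{⊗n}·U_{τ|b^n} ⊗ U_{π|b'^n})`;
if `H_n(ρ_b) ≥ Δ`, then `2^{(1-|π|)Δ} ≥ Tr(ρ_{bb'}^{⊗n}·U_{τ|b^n} ⊗ U_{π|b'^n})`.
Here `H_n(ρ) = (1/(1-n)) log₂ Tr ρ^n` and `|π|` is the number of cycles of `π`. -/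
theorem replica_symmetric_saddle_dominance {db db' : ℕ}
    (ρ : Matrix (Fin db × Fin db') (Fin db × Fin db') ℂ)
    (hρ : ρ.PosSemidef) (htr : ρ.trace = 1)
    (hpure : ∃ v : Fin db × Fin db' → ℂ, ρ = Matrix.vecMulVec v (star v))
    (n : ℕ) (hn : 2 ≤ n) (Δ : ℝ) (π : Equiv.Perm (Fin n)) (hπ : IsNonCrossingPerm π) :
    ((1 / (1 - (n : ℝ))) * Real.logb 2 (((ptraceB ρ ^ n).trace).re) ≤ Δ →
      ((tensorPow ρ n * permPairMatrix db db' n (finRotate n) π).trace).re ≤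
        (2 : ℝ) ^ (((n : ℝ) - (cycleCount π : ℝ)) * Δ) * ((ptraceB ρ ^ n).trace).re) ∧
    (Δ ≤ (1 / (1 - (n : ℝ))) * Real.logb 2 (((ptraceB ρ ^ n).trace).re) →
      ((tensorPow ρ n * permPairMatrix db db' n (finRotate n) π).trace).re ≤
        (2 : ℝ) ^ ((1 - (cycleCount π : ℝ)) * Δ)) := by
  obtain ⟨v, rfl⟩ := hpure
  obtain ⟨w, hw, hsum, hpow, hperm⟩ :=
    exists_permTrace_eq_of_posSemidef (posSemidef_ptraceB_vecMulVec v) ((trace_ptraceB _).trans htr)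
  rw [trace_tensorPow_mul_permPairMatrix, hperm, hpow, Complex.ofReal_re, Complex.ofReal_re]
  have hn0 : n ≠ 0 := by omega
  have hn1 : (0 : ℝ) < n - 1 := by
    have : (2 : ℝ) ≤ n := by exact_mod_cast hn
    linarith
  have hF := permTrace_diagonal_le_rpow hw hsum hn ((finRotate n)⁻¹ * π)
  have hp0 := sum_pow_pos hw hsum n
  have hp1 := sum_pow_le_one hw hsum hn0
  set p := ∑ j, w j ^ n
  set F := permTrace ((finRotate n)⁻¹ * π) (Matrix.diagonal w)
  have hk1 : (1 : ℝ) ≤ cycleCount π := by exact_mod_cast cycleCount_pos hn0 π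
  have hkn : (cycleCount π : ℝ) ≤ n := by
    exact_mod_cast (cycleCount_le_orbitCount π).trans (orbitCount_le π)
  have hgen : (orbitCount ((finRotate n)⁻¹ * π) : ℝ) + cycleCount π ≤ n + 1 := by
    exact_mod_cast (Nat.add_le_add_left (cycleCount_le_orbitCount π) _).trans
      (orbitCount_finRotate_inv_mul_add_le hn0 π)
  set H := (1 / (1 - (n : ℝ))) * Real.logb 2 p with hH
  have hlog : Real.logb 2 p = -((n : ℝ) - 1) * H := by
    have : (1 - (n : ℝ)) ≠ 0 := by linarith
    rw [hH]
    field_simp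
    ring
  have hpH : p = 2 ^ (-((n : ℝ) - 1) * H) := by
    rw [← hlog, Real.rpow_logb two_pos (by norm_num) hp0]
  have hFH : F ≤ 2 ^ ((1 - (cycleCount π : ℝ)) * H) := by
    refine (hF.trans (Real.rpow_le_rpow_of_exponent_ge hp0 hp1
      (div_le_div_of_nonneg_right (by linarith : (cycleCount π : ℝ) - 1 ≤ _) hn1.le))).trans_eq ?_
    rw [hpH, ← Real.rpow_mul two_pos.le]
    congr 1
    field_simp
    ring
  refine ⟨fun h => hFH.trans ?_, fun h => hFH.trans ?_⟩
  · rw [hpH, ← Real.rpow_add two_pos]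
    refine Real.rpow_le_rpow_of_exponent_le one_le_two ?_
    nlinarith [mul_nonneg (sub_nonneg.2 hkn) (sub_nonneg.2 h)]
  · refine Real.rpow_le_rpow_of_exponent_le one_le_two ?_
    nlinarith [mul_nonneg (sub_nonneg.2 hk1) (sub_nonneg.2 h)]
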